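/- Let X ⊆ ℂ be a nonempty open connected set and let h : X → 𝔻* be a holomorphic covering map onto the punctured unit disk 𝔻* = {z ∈ ℂ : 0 < |z| < 1}. Then one of the following holds: (a) there exists a biholomorphism ψ from X onto the left half-plane H_l = {z ∈ ℂ : Re z < 0} such that h = exp ∘ ψ; or (b) there exist an integer n ≥ 1 and a biholomorphism ψ from X onto 𝔻* such that h(z) = (ψ(z))^n for all z ∈ X. -/

import Mathlib

open Complex

/-- The punctured unit disk. -/
def Dstar : Set ℂ := Metric.ball 0 1 \ {0}

/-- The left half-plane. -/
def LeftHalf : Set ℂ := {z : ℂ | z.re < 0}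

theorem isOpen_LeftHalf : IsOpen LeftHalf := isOpen_lt Complex.continuous_re continuous_const

theorem isOpen_Dstar : IsOpen Dstar := Metric.isOpen_ball.sdiff isClosed_singleton

theorem exp_mem_Dstar_iff (w : ℂ) : Complex.exp w ∈ Dstar ↔ w ∈ LeftHalf := by
  simp [Dstar, LeftHalf, Complex.norm_exp, Complex.exp_ne_zero]

theorem simplyConnected_LeftHalf : SimplyConnectedSpace LeftHalf := by
  have hc : Convex ℝ LeftHalf := convex_halfSpace_re_lt 0
  have : ContractibleSpace LeftHalf := hc.contractibleSpace ⟨-1, by simp [LeftHalf]⟩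
  infer_instance

/-- The exponential as a map from the half plane to the punctured disk. -/
noncomputable def expD (w : LeftHalf) : Dstar := ⟨Complex.exp w, (exp_mem_Dstar_iff w).2 w.2⟩

theorem continuous_expD : Continuous expD :=
  (Complex.continuous_exp.comp continuous_subtype_val).subtype_mk _

theorem isLocalHomeomorph_expD : IsLocalHomeomorph expD := by
  have h1 : IsLocalHomeomorph (fun z : ℂ ↦ (⟨_, z.exp_ne_zero⟩ : {z : ℂ // z ≠ 0})) :=
    Complex.isCoveringMap_exp.isLocalHomeomorph
  have h2 : IsLocalHomeomorph (Subtype.val : {z : ℂ // z ≠ 0} → ℂ) :=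
    (IsOpen.isOpenEmbedding_subtypeVal (isOpen_ne)).isLocalHomeomorph
  have h3 : IsLocalHomeomorph (Subtype.val : LeftHalf → ℂ) :=
    (IsOpen.isOpenEmbedding_subtypeVal isOpen_LeftHalf).isLocalHomeomorph
  have h4 : IsLocalHomeomorph (Subtype.val : Dstar → ℂ) :=
    (IsOpen.isOpenEmbedding_subtypeVal isOpen_Dstar).isLocalHomeomorph
  exact IsLocalHomeomorph.of_comp (g := (Subtype.val : Dstar → ℂ)) ((h2.comp h1).comp h3) h4
    continuous_expD

/-- Translation by `2πik`. -/
noncomputable def shift (k : ℤ) (w : LeftHalf) : LeftHalf :=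
  ⟨w.1 + k * (2 * Real.pi * I), by
    have := w.2
    simpa [LeftHalf] using this⟩

theorem continuous_shift (k : ℤ) : Continuous (shift k) :=
  (continuous_subtype_val.add continuous_const).subtype_mk _

theorem expD_shift (k : ℤ) (w : LeftHalf) : expD (shift k w) = expD w := by
  apply Subtype.ext
  exact Complex.exp_eq_exp_iff_exists_int.2 ⟨k, rfl⟩

theorem shift_add (k l : ℤ) (w : LeftHalf) : shift (k + l) w = shift k (shift l w) := by
  apply Subtype.ext
  simp only [shift]
  push_cast
  ring

theorem shift_zero (w : LeftHalf) : shift 0 w = w := by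
  apply Subtype.ext
  simp [shift]

theorem exists_unif {X : Set ℂ} (hXo : IsOpen X) (hXc : IsConnected X) (p : X → Dstar)
    (hcov : IsCoveringMap p) :
    ∃ F : LeftHalf → X, Continuous F ∧ Function.Surjective F ∧ IsOpenMap F ∧
      (∀ w, p (F w) = expD w) ∧
      ∃ G : AddSubgroup ℤ, ∀ w w' : LeftHalf, F w = F w' ↔
        ∃ k ∈ G, (w : ℂ) = w' + k * (2 * Real.pi * I) := by
  have := simplyConnected_LeftHalf
  have := isOpen_LeftHalf.locallyPathConnectedSpace
  obtain ⟨x₀, hx₀⟩ := hXc.nonempty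
  set e₀ : X := ⟨x₀, hx₀⟩
  have hne : ((p e₀ : Dstar) : ℂ) ≠ 0 := (p e₀).2.2
  set a : ℂ := Complex.log (p e₀)
  have ha : Complex.exp a = p e₀ := Complex.exp_log hne
  have haH : a ∈ LeftHalf := (exp_mem_Dstar_iff a).1 (ha ▸ (p e₀).2)
  obtain ⟨F, ⟨hF0, hF⟩, -⟩ := hcov.existsUnique_continuousMap_lifts ⟨expD, continuous_expD⟩
    ⟨a, haH⟩ e₀ (Subtype.ext ha.symm)
  have hpF : ∀ w, p (F w) = expD w := fun w => congrFun hF w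
  have hsh : ∀ k w, F (shift k w) = F w → ∀ w', F (shift k w') = F w' := by
    intro k w hw w'
    have := hcov.eq_of_comp_eq (F.continuous.comp (continuous_shift k)) F.continuous
      (by funext v; simp [hpF, expD_shift]) w hw
    exact congrFun this w'
  refine ⟨F, F.continuous, ?_, ?_, hpF, ?_⟩
  · intro x
    have hpc : IsPathConnected X := hXo.isConnected_iff_isPathConnected.1 hXc
    have : PathConnectedSpace X := isPathConnected_iff_pathConnectedSpace.1 hpc
    let γ : Path e₀ x := PathConnectedSpace.somePath e₀ x
    let δ : C(unitInterval, {z : ℂ // z ≠ 0}) :=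
      ⟨fun t => ⟨p (γ t), (p (γ t)).2.2⟩,
        (continuous_subtype_val.comp (hcov.continuous.comp γ.continuous)).subtype_mk _⟩
    obtain ⟨Γ, hΓ, hΓ0⟩ := Complex.isCoveringMap_exp.exists_path_lifts δ a
      (by apply Subtype.ext; simp [δ, ha])
    have hΓ' : ∀ t, Complex.exp (Γ t) = p (γ t) := fun t => congrArg Subtype.val (congrFun hΓ t)
    have hΓH : ∀ t, Γ t ∈ LeftHalf := fun t =>
      (exp_mem_Dstar_iff _).1 ((hΓ' t).symm ▸ (p (γ t)).2)
    have key := hcov.eq_of_comp_eq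
      (g₁ := fun t => F ⟨Γ t, hΓH t⟩) (g₂ := γ)
      (F.continuous.comp (Γ.continuous.subtype_mk _)) γ.continuous
      (by funext t; simp only [Function.comp, hpF]; exact Subtype.ext (hΓ' t)) 0
      (by simp [hΓ0, hF0])
    refine ⟨⟨Γ 1, hΓH 1⟩, ?_⟩
    simpa using congrFun key 1
  · have : IsLocalHomeomorph (p ∘ F) := by
      rw [hF]; exact isLocalHomeomorph_expD
    exact (this.of_comp hcov.isLocalHomeomorph F.continuous).isOpenMap
  · refine ⟨{ carrier := {k | ∀ w, F (shift k w) = F w}, zero_mem' := ?_, add_mem' := ?_,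
              neg_mem' := ?_ }, ?_⟩
    · intro k l hk hl w
      rw [shift_add, hk, hl]
    · intro w
      rw [shift_zero]
    · intro k hk w
      rw [← hk (shift (-k) w), ← shift_add, add_neg_cancel, shift_zero]
    · intro w w'
      constructor
      · intro hw
        have h1 : expD w = expD w' := by rw [← hpF, ← hpF, hw]
        obtain ⟨k, hk⟩ := Complex.exp_eq_exp_iff_exists_int.1 (congrArg Subtype.val h1)
        have hk' : w = shift k w' := Subtype.ext hk
        exact ⟨k, hsh k w' (by rw [← hk', hw]), hk⟩
      · rintro ⟨k, hkG, hk⟩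
        have hk' : w = shift k w' := Subtype.ext hk
        rw [hk']
        exact hkG w'

theorem descend {X : Set ℂ} (hXo : IsOpen X) (h : ℂ → ℂ) (hhol : DifferentiableOn ℂ h X)
    (F : LeftHalf → X) (hFc : Continuous F) (hFs : Function.Surjective F) (hFo : IsOpenMap F)
    (hF : ∀ w, h (F w) = Complex.exp w) (E p : ℂ → ℂ) (hE : Continuous E)
    (hFE : ∀ w w' : LeftHalf, F w = F w' ↔ E w = E w')
    (hpE : ∀ w ∈ LeftHalf, p (E w) = Complex.exp w)
    (hp : ∀ w ∈ LeftHalf, ∃ p' : ℂ, p' ≠ 0 ∧ HasStrictDerivAt p p' (E w)) :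
    ∃ ψ : ℂ → ℂ, DifferentiableOn ℂ ψ X ∧ Set.InjOn ψ X ∧
        ψ '' X = E '' LeftHalf ∧ ∀ z ∈ X, h z = p (ψ z) := by
  classical
  choose σ hσ using hFs
  let ψ : ℂ → ℂ := fun z => if hz : z ∈ X then E (σ ⟨z, hz⟩) else 0
  have hψ : ∀ x : X, ψ x = E (σ x) := fun x => by simp [ψ]
  have hψF : ∀ w, ψ (F w) = E w := fun w => by
    rw [hψ]; exact (hFE _ _).1 (hσ _)
  have hFs : Function.Surjective F := fun x => ⟨σ x, hσ x⟩
  have hhp : ∀ z ∈ X, h z = p (ψ z) := by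
    intro z hz
    obtain ⟨w, hw⟩ := hFs ⟨z, hz⟩
    have h2 := hF w
    have h3 := hψF w
    rw [hw] at h2 h3
    rw [h2, h3, hpE w w.2]
  have hcont : ContinuousOn ψ X := by
    rw [continuousOn_iff_continuous_domRestrict]
    have hq := hFo.isQuotientMap hFc hFs
    rw [hq.continuous_iff]
    have : X.domRestrict ψ ∘ F = fun w : LeftHalf => E w := by
      funext w; exact hψF w
    rw [this]
    exact hE.comp continuous_subtype_val
  refine ⟨ψ, ?_, ?_, ?_, hhp⟩
  · intro z hz
    obtain ⟨p', hp0, hp'⟩ := hp (σ ⟨z, hz⟩) (σ ⟨z, hz⟩).2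
    rw [← hψ ⟨z, hz⟩] at hp'
    have hX : X ∈ nhds z := hXo.mem_nhds hz
    have hca : ContinuousAt ψ z := hcont.continuousAt hX
    have ev : ψ =ᶠ[nhds z] fun y => hp'.localInverse p p' (ψ z) hp0 (h y) := by
      filter_upwards [hca.eventually (hp'.eventually_left_inverse hp0), hX] with y hy hyX
      rw [hhp y hyX]; exact hy.symm
    have hd : DifferentiableAt ℂ (fun y => hp'.localInverse p p' (ψ z) hp0 (h y)) z := by
      have h1 := (hp'.to_localInverse hp0).hasDerivAt.differentiableAt
      rw [← hhp z hz] at h1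
      exact DifferentiableAt.comp (g := hp'.localInverse p p' (ψ z) hp0) z h1
        (hhol.differentiableAt hX)
    exact (hd.congr_of_eventuallyEq ev).differentiableWithinAt
  · intro z hz z' hz' hzz
    rw [show ψ z = E (σ ⟨z, hz⟩) from hψ ⟨z, hz⟩,
      show ψ z' = E (σ ⟨z', hz'⟩) from hψ ⟨z', hz'⟩] at hzz
    have := (hFE _ _).2 hzz
    rw [hσ, hσ] at this
    exact congrArg Subtype.val this
  · ext y
    constructor
    · rintro ⟨z, hz, rfl⟩
      exact ⟨σ ⟨z, hz⟩, (σ ⟨z, hz⟩).2, (hψ ⟨z, hz⟩).symm⟩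
    · rintro ⟨w, hw, rfl⟩
      exact ⟨F ⟨w, hw⟩, (F ⟨w, hw⟩).2, hψF ⟨w, hw⟩⟩

/-- Theorem 2.3: classification of holomorphic coverings of the punctured disk
(for plane domains). -/
theorem covering_of_punctured_disk
    (X : Set ℂ) (hXo : IsOpen X) (hXc : IsConnected X)
    (h : ℂ → ℂ) (hhol : DifferentiableOn ℂ h X)
    (hmaps : ∀ z ∈ X, h z ∈ Dstar)
    (hcov : IsCoveringMap fun x : X => (⟨h x.1, hmaps x.1 x.2⟩ : Dstar)) :
    (∃ ψ : ℂ → ℂ, DifferentiableOn ℂ ψ X ∧ Set.InjOn ψ X ∧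
        ψ '' X = {z : ℂ | z.re < 0} ∧ ∀ z ∈ X, h z = Complex.exp (ψ z)) ∨
    (∃ n : ℕ, 1 ≤ n ∧ ∃ ψ : ℂ → ℂ, DifferentiableOn ℂ ψ X ∧ Set.InjOn ψ X ∧
        ψ '' X = Dstar ∧ ∀ z ∈ X, h z = (ψ z) ^ n) := by
  obtain ⟨F, hFc, hFs, hFo, hF, G, hG⟩ := exists_unif hXo hXc _ hcov
  have hF' : ∀ w, h (F w) = Complex.exp w := fun w => congrArg Subtype.val (hF w)
  obtain ⟨m, hm⟩ := Int.subgroup_cyclic G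
  have hGm : ∀ k, k ∈ G ↔ m ∣ k := by
    intro k
    rw [hm, AddSubgroup.mem_closure_singleton]
    constructor
    · rintro ⟨n, rfl⟩; simp
    · rintro ⟨c, rfl⟩; exact ⟨c, by simp [mul_comm]⟩
  by_cases hm0 : m = 0
  · left
    obtain ⟨ψ, h1, h2, h3, h4⟩ := descend hXo h hhol F hFc hFs hFo hF' id Complex.exp
      continuous_id (fun w w' => by
        rw [hG]
        simp [hGm, hm0]) (fun w _ => rfl)
      (fun w _ => ⟨_, Complex.exp_ne_zero _, Complex.hasStrictDerivAt_exp _⟩)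
    exact ⟨ψ, h1, h2, by rw [h3, Set.image_id]; rfl, h4⟩
  · right
    set n := m.natAbs with hn
    have hn1 : 1 ≤ n := by omega
    have hnC : (n : ℂ) ≠ 0 := by exact_mod_cast (by omega : n ≠ 0)
    have hGn : ∀ k, k ∈ G ↔ (n : ℤ) ∣ k := by
      intro k; rw [hGm, hn, Int.natAbs_dvd]
    have hpow : ∀ w : ℂ, Complex.exp (w / n) ^ n = Complex.exp w := by
      intro w
      rw [← Complex.exp_nat_mul, mul_div_cancel₀ _ hnC]
    have hdiv : ∀ w : ℂ, w / n ∈ LeftHalf ↔ w ∈ LeftHalf := by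
      intro w
      have : (0 : ℝ) < n := by exact_mod_cast hn1
      simp [LeftHalf, Complex.div_natCast_re, div_neg_iff, this, this.not_gt]
    refine ⟨n, hn1, ?_⟩
    obtain ⟨ψ, h1, h2, h3, h4⟩ := descend hXo h hhol F hFc hFs hFo hF'
      (fun w => Complex.exp (w / n)) (fun z => z ^ n)
      (by fun_prop) (fun w w' => by
        rw [hG, Complex.exp_eq_exp_iff_exists_int]
        constructor
        · rintro ⟨k, hk, hw⟩
          obtain ⟨c, rfl⟩ := (hGn k).1 hk
          refine ⟨c, ?_⟩
          rw [hw]; push_cast; field_simp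
        · rintro ⟨c, hc⟩
          refine ⟨n * c, (hGn _).2 ⟨c, rfl⟩, ?_⟩
          rw [div_eq_iff hnC] at hc
          rw [hc]; push_cast; field_simp) (fun w _ => hpow w)
      (fun w _ => ⟨_, mul_ne_zero hnC (pow_ne_zero _ (Complex.exp_ne_zero _)),
        hasStrictDerivAt_pow n _⟩)
    refine ⟨ψ, h1, h2, ?_, h4⟩
    rw [h3]
    ext y
    constructor
    · rintro ⟨w, hw, rfl⟩
      exact (exp_mem_Dstar_iff _).2 ((hdiv w).2 hw)
    · intro hy
      have hy0 : y ≠ 0 := hy.2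
      refine ⟨n * Complex.log y, ?_, ?_⟩
      · rw [← hdiv, mul_div_cancel_left₀ _ hnC, ← exp_mem_Dstar_iff, Complex.exp_log hy0]
        exact hy
      · simp only [mul_div_cancel_left₀ _ hnC, Complex.exp_log hy0]
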